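/- For the family of chains X^{(a)}, define R_a := Σ_{b∈ℓ(a)} π^{(a)}(B_b)²/(μ^{(a)}_b·π^{(a)}(b)). If R_a / E[T^a_0] → 0 as a → ∞, then E[T^a_0] / E[T^0_a] → 0 as a → ∞; in fact E[T^a_0]/(E[T^a_0] + E[T^0_a]) ≤ R_a/E[T^a_0]. -/

import Mathlib

open MeasureTheory ProbabilityTheory Filter Topology ENNReal

noncomputable section

/-- A discrete-time birth-and-death chain on a countable rooted tree `I`.
The tree is encoded by a root, a parent map and a depth function; the chain is
encoded by its transition matrix `P` (nonzero only between tree-neighbours and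
on the diagonal) and by the laws `law x` of the trajectories started at `x`,
characterised by the cylinder formula.  `invm` is the reversible invariant
probability measure of the chain (positive recurrence). -/
structure TreeChain (I : Type*) [MeasurableSpace I] where
  root : I
  par : I → I
  depth : I → ℕ
  par_root : par root = root
  depth_root : depth root = 0
  depth_eq_zero : ∀ x, depth x = 0 → x = root
  depth_par : ∀ x, x ≠ root → depth x = depth (par x) + 1
  P : I → I → ℝ≥0∞
  P_row : ∀ x, ∑' y, P x y = 1
  P_support : ∀ x y, P x y ≠ 0 → y = x ∨ y = par x ∨ x = par y
  lam_pos : ∀ x, x ≠ root → P (par x) x ≠ 0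
  mu_pos : ∀ x, x ≠ root → P x (par x) ≠ 0
  law : I → Measure (ℕ → I)
  law_prob : ∀ x, IsProbabilityMeasure (law x)
  law_start : ∀ x, law x {ω | ω 0 = x} = 1
  law_cyl : ∀ x (n : ℕ) (γ : ℕ → I), γ 0 = x →
    law x {ω | ∀ i ≤ n, ω i = γ i} = ∏ i ∈ Finset.range n, P (γ i) (γ (i + 1))
  invm : I → ℝ≥0∞
  invm_pos : ∀ x, invm x ≠ 0
  invm_sum : ∑' x, invm x = 1
  invm_rev : ∀ x y, invm x * P x y = invm y * P y x

/-- The hitting time of `y`, as an extended nonnegative real (`∞` if `y` is never hit). -/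
def hitTime {I : Type*} (y : I) (ω : ℕ → I) : ℝ≥0∞ :=
  ⨅ (t : ℕ) (_ : ω t = y), (t : ℝ≥0∞)

namespace TreeChain

variable {I : Type*} [MeasurableSpace I] (c : TreeChain I)

/-- The branch `B_x` stemming from `x`: the set of descendants of `x` (including `x`). -/
def branch (x : I) : Set I := {y | ∃ n, c.par^[n] y = x}

/-- The set `ℓ(x)` of vertices on the path from `x` to the root, the root excluded. -/
def pathToRoot (x : I) : Set I := {y | ∃ i < c.depth x, c.par^[i] x = y}

/-- The set `σ(x)` of children of `x`. -/
def children (x : I) : Set I := {y | y ≠ c.root ∧ c.par y = x}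

/-- `μ_x`, the transition probability from `x` to its parent. -/
def mu (x : I) : ℝ≥0∞ := c.P x (c.par x)

/-- `λ_x`, the transition probability from the parent of `x` to `x`. -/
def lamP (x : I) : ℝ≥0∞ := c.P (c.par x) x

/-- `π(A)`, the invariant mass of a set of vertices. -/
def piSet (A : Set I) : ℝ≥0∞ := ∑' y : A, c.invm (y : I)

/-- `E[T^x_y]`, the expected hitting time of `y` for the chain started at `x`. -/
def ET (x y : I) : ℝ≥0∞ := ∫⁻ ω, hitTime y ω ∂(c.law x)

/-- `E[(T^x_y)²]`, the second moment of the hitting time of `y` started at `x`. -/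
def ET2 (x y : I) : ℝ≥0∞ := ∫⁻ ω, (hitTime y ω) ^ 2 ∂(c.law x)

/-- The normalised hitting time `T^x_y / E[T^x_y]` as a real random variable. -/
def ratio (x y : I) (ω : ℕ → I) : ℝ := (hitTime y ω).toReal / (c.ET x y).toReal

/-- `α(a)`: the child of the root lying on the path from `a` to the root. -/
def alphaVert (a : I) : I := c.par^[c.depth a - 1] a

/-- The drift constant `K_a = sup_{b ∈ B_{α(a)}} μ_b · E[T^b_{p(b)}]`. -/
def Kdrift (a : I) : ℝ≥0∞ :=
  ⨆ b ∈ c.branch (c.alphaVert a), c.mu b * c.ET b (c.par b)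

/-- The global constant `K'_a = sup_{b ∈ I} μ_b · E[T^b_{p(b)}]`. -/
def Kdrift' : ℝ≥0∞ := ⨆ b : I, c.mu b * c.ET b (c.par b)

/-- The quantity `Q_x = π(B_x)⁻¹ · Σ_{b ∈ B_x} π(B_b)²/(μ_b π(b))`. -/
def Qx (x : I) : ℝ≥0∞ :=
  (c.piSet (c.branch x))⁻¹ *
    ∑' b : c.branch x, (c.piSet (c.branch (b : I))) ^ 2 / (c.mu (b : I) * c.invm (b : I))

/-- `Q_a = sup_{x ∈ ℓ(a)} Q_x`. -/
def Qsup (a : I) : ℝ≥0∞ := ⨆ x ∈ c.pathToRoot a, c.Qx x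

/-- `R_a = Σ_{b ∈ ℓ(a)} π(B_b)²/(μ_b π(b))`. -/
def Rsum (a : I) : ℝ≥0∞ :=
  ∑' b : c.pathToRoot a, (c.piSet (c.branch (b : I))) ^ 2 / (c.mu (b : I) * c.invm (b : I))

/-- The set `C_{a,k}`: union over the vertices `a_l`, `k < l ≤ d(a)`, of the path from
`a_k` to the root, of the branches stemming from the children of `a_l` other
than `a_{l-1}`. -/
def Cset (a : I) (k : ℕ) : Set I :=
  {y | ∃ l, k + 1 ≤ l ∧ l ≤ c.depth a ∧
    ∃ ch, ch ∈ c.children (c.par^[l] a) ∧ ch ≠ c.par^[l - 1] a ∧ y ∈ c.branch ch}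

end TreeChain

/-- The strong drift condition `0^ℓ-SD` toward the root, for a family of chains
`c n` with distinguished vertices `a n` (the limit `a → ∞` being `n → ∞`). -/
def StrongDrift {I : ℕ → Type*} [∀ n, MeasurableSpace (I n)]
    (c : ∀ n, TreeChain (I n)) (a : ∀ n, I n) : Prop :=
  (∃ Kmu : ℝ≥0∞, 0 < Kmu ∧
      ∀ n, ∀ b ∈ (c n).branch ((c n).alphaVert (a n)), Kmu ≤ (c n).mu b) ∧
  Tendsto (fun n => ((c n).Kdrift (a n)) ^ 2 / (c n).ET (a n) (c n).root) atTop (𝓝 0)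


namespace TreeChain

/-- Measurable sets of trajectories do not distinguish coordinatewise inseparable trajectories. -/
lemma mem_iff_of_inseparable {I : Type*} [MeasurableSpace I] {M : Set (ℕ → I)}
    (hM : MeasurableSet M) {ω ω' : ℕ → I}
    (h : ∀ i S, MeasurableSet S → (ω i ∈ S ↔ ω' i ∈ S)) : ω ∈ M ↔ ω' ∈ M := by
  let m : MeasurableSpace (ℕ → I) :=
    { MeasurableSet' := fun M => ∀ ω ω' : ℕ → I,
        (∀ i S, MeasurableSet S → (ω i ∈ S ↔ ω' i ∈ S)) → (ω ∈ M ↔ ω' ∈ M)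
      measurableSet_empty := fun _ _ _ => Iff.rfl
      measurableSet_compl := fun _ hs ω ω' h => not_congr (hs ω ω' h)
      measurableSet_iUnion := fun f hf ω ω' h => by
        simp only [Set.mem_iUnion]
        exact exists_congr fun i => hf i ω ω' h }
  have hle : (MeasurableSpace.pi : MeasurableSpace (ℕ → I)) ≤ m := by
    refine iSup_le fun i => ?_
    rintro _ ⟨S, hS, rfl⟩
    exact fun ω ω' h => h i S hS
  exact hle M hM ω ω' h

variable {I : Type*} [MeasurableSpace I] (c : TreeChain I)

lemma law_one_step (z w : I) : c.law z {ω | ω 0 = z ∧ ω 1 = w} = c.P z w := by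
  have h := c.law_cyl z 1 (fun i => if i = 0 then z else w) (by simp)
  simp only [Finset.prod_range_one, if_true, zero_add, one_ne_zero, if_false] at h
  rw [← h]
  congr 1
  ext ω
  constructor
  · rintro ⟨h0, h1⟩ i hi
    interval_cases i <;> simp [h0, h1]
  · intro h
    exact ⟨by simpa using h 0 (by omega), by simpa using h 1 le_rfl⟩

/-- A state that the sigma-algebra cannot separate from another state is never entered. -/
lemma P_eq_zero_of_inseparable [Countable I] {x y : I} (hxy : x ≠ y)
    (h : ∀ S, MeasurableSet S → (x ∈ S ↔ y ∈ S)) (z : I) : c.P z y = 0 := by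
  classical
  obtain ⟨A, hA⟩ : ∃ A : I → Set (ℕ → I), ∀ w, A w = {ω | ω 0 = z ∧ ω 1 = w} :=
    ⟨_, fun _ => rfl⟩
  have hmemA : ∀ w ω, ω ∈ A w ↔ ω 0 = z ∧ ω 1 = w := fun w ω => by rw [hA]; rfl
  have hsub : A y ⊆ toMeasurable (c.law z) (A x) := by
    intro ω hω
    have hmem : Function.update ω 1 x ∈ A x := by
      rw [hmemA] at hω ⊢
      simpa using hω.1
    refine (mem_iff_of_inseparable (measurableSet_toMeasurable _ _) fun i S hS => ?_).1
      (subset_toMeasurable _ _ hmem)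
    by_cases hi : i = 1
    · subst hi
      simpa [((hmemA _ _).1 hω).2] using h S hS
    · simp [hi]
  have hone : 1 ≤ ∑' w, if w = y then 0 else c.P z w := by
    calc 1 = c.law z {ω | ω 0 = z} := (c.law_start z).symm
      _ ≤ c.law z (⋃ w, if w = y then ∅ else toMeasurable (c.law z) (A w)) := by
        refine measure_mono fun ω hω => ?_
        by_cases hy : ω 1 = y
        · exact Set.mem_iUnion.2 ⟨x, by simpa [hxy] using hsub ((hmemA _ _).2 ⟨hω, hy⟩)⟩
        · exact Set.mem_iUnion.2 ⟨ω 1, by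
            simpa [hy] using subset_toMeasurable (c.law z) (A (ω 1))
              ((hmemA _ _).2 ⟨hω, rfl⟩)⟩
      _ ≤ ∑' w, c.law z (if w = y then ∅ else toMeasurable (c.law z) (A w)) :=
        measure_iUnion_le _
      _ = ∑' w, if w = y then 0 else c.P z w := by
        refine tsum_congr fun w => ?_
        split_ifs
        · simp
        · rw [measure_toMeasurable, hA, c.law_one_step]
  have hrow : ∑' w, c.P z w = c.P z y + ∑' w, if w = y then 0 else c.P z w :=
    ENNReal.tsum_eq_add_tsum_ite y
  rw [c.P_row z] at hrow
  have hle : c.P z y + 1 ≤ 0 + 1 := by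
    rw [zero_add]
    calc c.P z y + 1 ≤ c.P z y + ∑' w, if w = y then 0 else c.P z w := by gcongr
      _ = 1 := hrow.symm
  exact nonpos_iff_eq_zero.1 (ENNReal.le_of_add_le_add_right one_ne_top hle)

/-- The cylinder formula forces the sigma-algebra of the state space to be discrete. -/
lemma measurableSingletonClass [Countable I] (c : TreeChain I) : MeasurableSingletonClass I := by
  have hsep : ∀ x y : I, x ≠ y → ∃ S, MeasurableSet S ∧ x ∈ S ∧ y ∉ S := by
    intro x y hxy
    by_contra! hcon
    have h : ∀ S, MeasurableSet S → (x ∈ S ↔ y ∈ S) := fun S hS =>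
      ⟨hcon S hS, fun hy => by
        by_contra hx
        exact hcon Sᶜ hS.compl hx hy⟩
    by_cases hy : y = c.root
    · exact c.lam_pos x (hy ▸ hxy)
        (c.P_eq_zero_of_inseparable hxy.symm (fun S hS => (h S hS).symm) _)
    · exact c.lam_pos y hy (c.P_eq_zero_of_inseparable hxy h _)
  refine ⟨fun x => ?_⟩
  choose! S hS hxS hyS using hsep x
  have : ({x} : Set I) = ⋂ y ∈ {y | x ≠ y}, S y := by
    ext w
    simp only [Set.mem_singleton_iff, Set.mem_iInter, Set.mem_ofPred_eq]
    refine ⟨?_, fun hw => ?_⟩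
    · rintro rfl y hy
      exact hxS y hy
    · by_contra hne
      exact hyS w (Ne.symm hne) (hw w (Ne.symm hne))
  rw [this]
  exact MeasurableSet.biInter (Set.to_countable _) fun y hy => hS y hy

open Classical in
/-- The probability that the chain started at `x` has not visited `z` up to time `t`. -/
def survival (z : I) : ℕ → I → ℝ≥0∞
  | 0, x => if x = z then 0 else 1
  | t + 1, x => if x = z then 0 else ∑' y, c.P x y * survival z t y

lemma survival_self (z : I) (t : ℕ) : c.survival z t z = 0 := by
  cases t <;> simp [survival]

lemma survival_succ {z x : I} (hx : x ≠ z) (t : ℕ) :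
    c.survival z (t + 1) x = ∑' y, c.P x y * c.survival z t y := by
  simp [survival, hx]

lemma survival_le_one (z : I) (t : ℕ) (x : I) : c.survival z t x ≤ 1 := by
  induction t generalizing x with
  | zero => unfold survival; split_ifs <;> simp
  | succ t ih =>
    by_cases hx : x = z
    · simp [hx, survival_self]
    · rw [c.survival_succ hx, ← c.P_row x]
      exact ENNReal.tsum_le_tsum fun y => mul_le_of_le_one_right' (ih y)

lemma law_prefix_avoid [Countable I] [MeasurableSingletonClass I] (x z : I) (t n : ℕ)
    (γ : ℕ → I) (hγ : γ 0 = x) :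
    c.law x {ω | (∀ i ≤ n, ω i = γ i) ∧ ∀ i ≤ t, ω (n + i) ≠ z} =
      (∏ i ∈ Finset.range n, c.P (γ i) (γ (i + 1))) * c.survival z t (γ n) := by
  classical
  by_cases hz : γ n = z
  · rw [hz, survival_self, mul_zero]
    convert measure_empty (μ := c.law x)
    refine Set.eq_empty_of_forall_notMem fun ω hω => hω.2 0 (Nat.zero_le _) ?_
    rw [add_zero, hω.1 n le_rfl, hz]
  induction t generalizing n γ with
  | zero =>
    rw [← c.law_cyl x n γ hγ]
    simp only [survival, hz, if_false, mul_one]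
    congr 1
    ext ω
    refine ⟨fun h => h.1, fun h => ⟨h, fun i hi => ?_⟩⟩
    rw [Nat.le_zero.1 hi, add_zero, h n le_rfl]
    exact hz
  | succ t ih =>
    let g : I → ℕ → I := fun y => Function.update γ (n + 1) y
    have hg : ∀ y, ∀ i ≤ n, g y i = γ i := fun y i hi =>
      Function.update_of_ne (by omega) _ _
    have hg1 : ∀ y, g y (n + 1) = y := fun y => Function.update_self _ _ _
    let A : I → Set (ℕ → I) := fun y =>
      {ω | (∀ i ≤ n + 1, ω i = g y i) ∧ ∀ i ≤ t, ω (n + 1 + i) ≠ z}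
    have hmeas : ∀ y, MeasurableSet (A y) := fun y => by
      have he : A y = (⋂ i ∈ {i | i ≤ n + 1}, (fun ω : ℕ → I => ω i) ⁻¹' {g y i}) ∩
          ⋂ i ∈ {i | i ≤ t}, (fun ω : ℕ → I => ω (n + 1 + i)) ⁻¹' {z}ᶜ := by
        ext ω; simp [A]
      rw [he]
      exact (MeasurableSet.biInter (Set.to_countable _) fun i _ =>
        measurable_pi_apply i (measurableSet_singleton _)).inter
        (MeasurableSet.biInter (Set.to_countable _) fun i _ =>
        measurable_pi_apply (n + 1 + i) (measurableSet_singleton _).compl)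
    have hdisj : Pairwise (Function.onFun Disjoint A) := by
      intro y y' hyy'
      refine Set.disjoint_left.2 fun ω h h' => hyy' ?_
      rw [← hg1 y, ← hg1 y', ← h.1 _ le_rfl, ← h'.1 _ le_rfl]
    have hunion : {ω | (∀ i ≤ n, ω i = γ i) ∧ ∀ i ≤ t + 1, ω (n + i) ≠ z} = ⋃ y, A y := by
      ext ω
      simp only [Set.mem_iUnion, Set.mem_ofPred_eq, A]
      constructor
      · rintro ⟨h1, h2⟩
        refine ⟨ω (n + 1), fun i hi => ?_, fun i hi => ?_⟩
        · rcases Nat.le_succ_iff.1 hi with hi | rfl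
          · rw [hg _ i hi, h1 i hi]
          · exact (hg1 _).symm
        · rw [add_assoc, add_comm 1 i]
          exact h2 (i + 1) (by omega)
      · rintro ⟨y, h1, h2⟩
        have h1' : ∀ i ≤ n, ω i = γ i := fun i hi => by rw [h1 i (by omega), hg y i hi]
        refine ⟨h1', fun i hi => ?_⟩
        cases i with
        | zero => rw [add_zero, h1' n le_rfl]; exact hz
        | succ i =>
          rw [add_comm i 1, ← add_assoc]
          exact h2 i (by omega)
    rw [hunion, measure_iUnion hdisj hmeas, c.survival_succ hz, ← ENNReal.tsum_mul_left]
    refine tsum_congr fun y => ?_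
    have hprod : ∏ i ∈ Finset.range (n + 1), c.P (g y i) (g y (i + 1)) =
        (∏ i ∈ Finset.range n, c.P (γ i) (γ (i + 1))) * c.P (γ n) y := by
      rw [Finset.prod_range_succ, hg y n le_rfl, hg1]
      congr 1
      refine Finset.prod_congr rfl fun i hi => ?_
      have := Finset.mem_range.1 hi
      rw [hg y i (by omega), hg y (i + 1) (by omega)]
    by_cases hy : y = z
    · rw [hy, survival_self, mul_zero, mul_zero]
      convert measure_empty (μ := c.law x)
      refine Set.eq_empty_of_forall_notMem fun ω hω => hω.2 0 (Nat.zero_le _) ?_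
      rw [add_zero, hω.1 _ le_rfl, hg1]
    · have h0 : g y 0 = x := by rw [hg y 0 (Nat.zero_le _), hγ]
      have := ih (n + 1) (g y) h0 (by rwa [hg1])
      rw [hprod, hg1] at this
      rw [← mul_assoc]
      exact this

lemma law_avoid [Countable I] [MeasurableSingletonClass I] (x z : I) (t : ℕ) :
    c.law x {ω | ∀ i ≤ t, ω i ≠ z} = c.survival z t x := by
  have := c.law_prob x
  have hstart : ∀ᵐ ω ∂(c.law x), ω 0 = x := by
    rw [ae_iff, ← Set.compl_ofPred, prob_compl_eq_zero_iff]
    · exact c.law_start x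
    · exact (measurable_pi_apply (X := fun _ => I) 0) (measurableSet_singleton x)
  have h := c.law_prefix_avoid x z t 0 (fun _ => x) rfl
  simp only [Finset.range_zero, Finset.prod_empty, one_mul, zero_add] at h
  rw [← h]
  refine measure_congr ?_
  filter_upwards [hstart] with ω hω
  refine propext ⟨fun h => ⟨fun i hi => ?_, h⟩, fun h => h.2⟩
  rw [Nat.le_zero.1 hi]
  exact hω

open Classical in
lemma hitTime_eq_tsum {I : Type*} (z : I) (ω : ℕ → I) :
    hitTime z ω = ∑' t : ℕ, if ∀ i ≤ t, ω i ≠ z then (1 : ℝ≥0∞) else 0 := by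
  by_cases hex : ∃ t, ω t = z
  · have hfind : hitTime z ω = (Nat.find hex : ℝ≥0∞) := by
      refine le_antisymm (iInf₂_le (Nat.find hex) (Nat.find_spec hex)) (le_iInf₂ fun t ht => ?_)
      exact_mod_cast Nat.find_min' hex ht
    have hiff : ∀ t, (∀ i ≤ t, ω i ≠ z) ↔ t < Nat.find hex := fun t => by
      rw [Nat.lt_find_iff]
    simp only [hiff]
    rw [hfind, tsum_eq_sum (s := Finset.range (Nat.find hex))]
    · rw [Finset.sum_congr rfl fun t ht => if_pos (Finset.mem_range.1 ht)]
      simp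
    · intro t ht
      simpa using ht
  · push Not at hex
    simp [hitTime, hex]

lemma ET_eq_tsum_survival [Countable I] [MeasurableSingletonClass I] (x z : I) :
    c.ET x z = ∑' t, c.survival z t x := by
  classical
  have hmeas : ∀ t : ℕ, MeasurableSet {ω : ℕ → I | ∀ i ≤ t, ω i ≠ z} := fun t => by
    have he : {ω : ℕ → I | ∀ i ≤ t, ω i ≠ z} =
        ⋂ i ∈ {i | i ≤ t}, (fun ω : ℕ → I => ω i) ⁻¹' {z}ᶜ := by
      ext ω; simp
    rw [he]
    exact MeasurableSet.biInter (Set.to_countable _) fun i _ =>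
      measurable_pi_apply i (measurableSet_singleton _).compl
  have hind : ∀ (t : ℕ) (ω : ℕ → I), (if ∀ i ≤ t, ω i ≠ z then (1 : ℝ≥0∞) else 0) =
      {ω : ℕ → I | ∀ i ≤ t, ω i ≠ z}.indicator 1 ω := fun t ω => by
    simp [Set.indicator_apply]
  simp only [ET, hitTime_eq_tsum, hind]
  rw [lintegral_tsum fun t => (measurable_one.indicator (hmeas t)).aemeasurable]
  refine tsum_congr fun t => ?_
  rw [lintegral_indicator_one (hmeas t), law_avoid]

lemma piSet_eq_tsum_indicator (S : Set I) : c.piSet S = ∑' x, S.indicator c.invm x :=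
  tsum_subtype S c.invm

lemma piSet_add_piSet_compl (S : Set I) : c.piSet S + c.piSet Sᶜ = 1 := by
  rw [piSet_eq_tsum_indicator, piSet_eq_tsum_indicator, ← ENNReal.tsum_add, ← c.invm_sum]
  exact tsum_congr fun x => congrFun (Set.indicator_self_add_compl S c.invm) x

lemma P_le_one (x y : I) : c.P x y ≤ 1 := c.P_row x ▸ ENNReal.le_tsum y

lemma invm_le_one (x : I) : c.invm x ≤ 1 := c.invm_sum ▸ ENNReal.le_tsum x

lemma invm_ne_top (x : I) : c.invm x ≠ ∞ := ne_top_of_le_ne_top one_ne_top (c.invm_le_one x)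

lemma P_ne_top (x y : I) : c.P x y ≠ ∞ := ne_top_of_le_ne_top one_ne_top (c.P_le_one x y)

lemma P_eq_zero_symm {x y : I} (h : c.P x y = 0) : c.P y x = 0 := by
  have := c.invm_rev x y
  rw [h, mul_zero, eq_comm, mul_eq_zero] at this
  exact this.resolve_left (c.invm_pos y)

/-- `(u, v)` is the only edge along which the chain can leave `S`. -/
structure IsCut (S : Set I) (u v : I) : Prop where
  mem : u ∈ S
  notMem : v ∉ S
  eq_of_ne_zero : ∀ x ∈ S, ∀ y ∉ S, c.P x y ≠ 0 → x = u ∧ y = v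

variable {c} in
lemma IsCut.compl {S : Set I} {u v : I} (h : c.IsCut S u v) : c.IsCut Sᶜ v u where
  mem := h.notMem
  notMem := fun hn => hn h.mem
  eq_of_ne_zero x hx y hy hP :=
    (h.eq_of_ne_zero y (not_not.1 hy) x hx fun h0 => hP (c.P_eq_zero_symm h0)).symm

variable {c} in
open Classical in
lemma IsCut.flux_balance_at {S : Set I} {u v : I} (h : c.IsCut S u v) (y : I) :
    (∑' x, S.indicator c.invm x * c.P x y) + (if y = u then c.invm u * c.P u v else 0) =
      S.indicator c.invm y + if y = v then c.invm u * c.P u v else 0 := by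
  have hflux : ∀ x, S.indicator c.invm x * c.P x y =
      S.indicator (fun x => c.invm y * c.P y x) x := fun x => by
    by_cases hx : x ∈ S <;> simp [hx, c.invm_rev x y]
  have htotal : (∑' x, S.indicator (fun x => c.invm y * c.P y x) x) +
      ∑' x, Sᶜ.indicator (fun x => c.invm y * c.P y x) x = c.invm y := by
    rw [← ENNReal.tsum_add]
    calc _ = ∑' x, c.invm y * c.P y x := tsum_congr fun x =>
          congrFun (Set.indicator_self_add_compl S fun x => c.invm y * c.P y x) x
      _ = c.invm y := by rw [ENNReal.tsum_mul_left, c.P_row, mul_one]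
  have hzero : ∀ x, c.P y x = 0 → c.invm y * c.P y x = 0 := fun x hx => by rw [hx, mul_zero]
  simp only [hflux]
  by_cases hy : y ∈ S
  · have hyv : y ≠ v := fun e => h.notMem (e ▸ hy)
    rw [if_neg hyv, add_zero, Set.indicator_of_mem hy]
    refine Eq.trans ?_ htotal
    congr 1
    split_ifs with hyu
    · subst hyu
      rw [tsum_eq_single v, Set.indicator_of_mem (show v ∈ Sᶜ from h.notMem)]
      intro x hx
      refine Set.indicator_apply_eq_zero.2 fun hxS => hzero x ?_
      by_contra hP
      exact hx (h.eq_of_ne_zero y hy x hxS hP).2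
    · refine (ENNReal.tsum_eq_zero.2 fun x => ?_).symm
      refine Set.indicator_apply_eq_zero.2 fun hxS => hzero x ?_
      by_contra hP
      exact hyu (h.eq_of_ne_zero y hy x hxS hP).1
  · have hyu : y ≠ u := fun e => hy (e ▸ h.mem)
    rw [if_neg hyu, add_zero, Set.indicator_of_notMem hy, zero_add]
    split_ifs with hyv
    · subst hyv
      rw [tsum_eq_single u, Set.indicator_of_mem h.mem, c.invm_rev]
      intro x hx
      refine Set.indicator_apply_eq_zero.2 fun hxS => hzero x (c.P_eq_zero_symm ?_)
      by_contra hP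
      exact hx (h.eq_of_ne_zero x hxS y hy hP).1
    · refine ENNReal.tsum_eq_zero.2 fun x => ?_
      refine Set.indicator_apply_eq_zero.2 fun hxS => hzero x (c.P_eq_zero_symm ?_)
      by_contra hP
      exact hyv (h.eq_of_ne_zero x hxS y hy hP).2

variable {c} in
lemma IsCut.flux_balance {S : Set I} {u v : I} (h : c.IsCut S u v) (f : I → ℝ≥0∞) :
    (∑' x, S.indicator c.invm x * ∑' y, c.P x y * f y) + c.invm u * c.P u v * f u =
      (∑' x, S.indicator c.invm x * f x) + c.invm u * c.P u v * f v := by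
  classical
  have hswap : ∑' x, S.indicator c.invm x * ∑' y, c.P x y * f y =
      ∑' y, (∑' x, S.indicator c.invm x * c.P x y) * f y := by
    simp only [← ENNReal.tsum_mul_left, ← ENNReal.tsum_mul_right]
    rw [ENNReal.tsum_comm]
    simp only [mul_assoc]
  have hpoint : ∀ w : I, c.invm u * c.P u v * f w =
      ∑' y, (if y = w then c.invm u * c.P u v else 0) * f y := fun w => by
    rw [tsum_eq_single w fun y hy => by simp [hy], if_pos rfl]
  rw [hswap, hpoint u, hpoint v, ← ENNReal.tsum_add, ← ENNReal.tsum_add]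
  exact tsum_congr fun y => by rw [← add_mul, ← add_mul, h.flux_balance_at y]

variable {c} in
/-- Conservation of mass for the chain killed at `z`, in the part `S` of the tree. -/
lemma IsCut.survival_balance {S : Set I} {u v z : I} (h : c.IsCut S u v) (hz : z ∉ S) (t : ℕ) :
    (∑' x, S.indicator c.invm x * c.survival z t x) +
        c.invm u * c.P u v * ∑ s ∈ Finset.range t, c.survival z s u =
      c.piSet S + c.invm u * c.P u v * ∑ s ∈ Finset.range t, c.survival z s v := by
  have hne : ∀ x ∈ S, x ≠ z := fun x hx e => hz (e ▸ hx)
  induction t with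
  | zero =>
    simp only [Finset.range_zero, Finset.sum_empty, mul_zero, add_zero]
    rw [piSet_eq_tsum_indicator]
    refine tsum_congr fun x => ?_
    by_cases hx : x ∈ S
    · simp [survival, hne x hx]
    · simp [hx]
  | succ t ih =>
    have hstep : ∑' x, S.indicator c.invm x * c.survival z (t + 1) x =
        ∑' x, S.indicator c.invm x * ∑' y, c.P x y * c.survival z t y := by
      refine tsum_congr fun x => ?_
      by_cases hx : x ∈ S
      · rw [c.survival_succ (hne x hx)]
      · simp [hx]
    have hflux := h.flux_balance (c.survival z t)
    rw [← hstep] at hflux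
    rw [Finset.sum_range_succ, Finset.sum_range_succ, mul_add, mul_add, ← add_assoc, ← add_assoc,
      ← ih, add_right_comm, hflux]
    ring

variable {c} in
lemma IsCut.tsum_survival_le {S : Set I} {u v z : I} (h : c.IsCut S u v) (hz : z ∉ S) :
    c.invm u * c.P u v * ∑' t, c.survival z t u ≤
      c.piSet S + c.invm u * c.P u v * ∑' t, c.survival z t v := by
  have hlim : Tendsto (fun n => c.invm u * c.P u v * ∑ s ∈ Finset.range n, c.survival z s u) atTop
      (𝓝 (c.invm u * c.P u v * ∑' t, c.survival z t u)) :=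
    ENNReal.Tendsto.const_mul (ENNReal.tendsto_nat_tsum _)
      (Or.inr (ENNReal.mul_ne_top (c.invm_ne_top u) (c.P_ne_top u v)))
  refine le_of_tendsto' hlim fun n => ?_
  calc _ ≤ _ := le_add_self
    _ = _ := h.survival_balance hz n
    _ ≤ _ := by
      gcongr
      exact ENNReal.sum_le_tsum _

variable {c} in
lemma IsCut.tsum_survival_eq [Countable I] [MeasurableSingletonClass I] {S : Set I} {u v z : I}
    (h : c.IsCut S u v) (hz : z ∉ S) (hfin : ∀ x ∈ S, ∑' t, c.survival z t x ≠ ∞) :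
    c.invm u * c.P u v * ∑' t, c.survival z t u =
      c.piSet S + c.invm u * c.P u v * ∑' t, c.survival z t v := by
  have hlim : ∀ w, Tendsto
      (fun n => c.invm u * c.P u v * ∑ s ∈ Finset.range n, c.survival z s w) atTop
      (𝓝 (c.invm u * c.P u v * ∑' t, c.survival z t w)) := fun w =>
    ENNReal.Tendsto.const_mul (ENNReal.tendsto_nat_tsum _)
      (Or.inr (ENNReal.mul_ne_top (c.invm_ne_top u) (c.P_ne_top u v)))
  have hdecay : Tendsto (fun t => ∑' x, S.indicator c.invm x * c.survival z t x) atTop (𝓝 0) := by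
    have hdct := tendsto_lintegral_of_dominated_convergence (μ := Measure.count)
      (F := fun t x => S.indicator c.invm x * c.survival z t x) (f := fun _ => 0) c.invm
      (fun t => .of_discrete) (fun t => ae_of_all _ fun x => ?_) ?_ (ae_of_all _ fun x => ?_)
    · simpa [lintegral_count] using hdct
    · exact (mul_le_of_le_one_right' (c.survival_le_one z t x)).trans
        (Set.indicator_le_self S c.invm x)
    · rw [lintegral_count, c.invm_sum]
      exact one_ne_top
    · by_cases hx : x ∈ S
      · have := ENNReal.Tendsto.const_mul (a := S.indicator c.invm x)
          (ENNReal.tendsto_atTop_zero_of_tsum_ne_top (hfin x hx))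
          (Or.inr (by simpa [hx] using c.invm_ne_top x))
        simpa using this
      · simp [hx]
  have hleft := hdecay.add (hlim u)
  have hright := (tendsto_const_nhds (x := c.piSet S)).add (hlim v)
  simp only [h.survival_balance hz, zero_add] at hleft
  exact tendsto_nhds_unique hleft hright

lemma depth_par_le (x : I) : c.depth (c.par x) ≤ c.depth x := by
  by_cases hx : x = c.root
  · rw [hx, c.par_root]
  · rw [c.depth_par x hx]
    exact Nat.le_succ _

lemma depth_iterate_par_le (n : ℕ) (x : I) : c.depth (c.par^[n] x) ≤ c.depth x := by
  induction n with
  | zero => rfl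
  | succ n ih =>
    rw [Function.iterate_succ_apply']
    exact (c.depth_par_le _).trans ih

lemma depth_iterate_par (n : ℕ) (x : I) (hn : n ≤ c.depth x) :
    c.depth (c.par^[n] x) = c.depth x - n := by
  induction n with
  | zero => rfl
  | succ n ih =>
    have ih := ih (by omega)
    have hne : c.par^[n] x ≠ c.root := fun e => by
      rw [e, c.depth_root] at ih
      omega
    rw [c.depth_par _ hne] at ih
    rw [Function.iterate_succ_apply']
    omega

lemma iterate_par_ne_root {n : ℕ} {x : I} (hn : n < c.depth x) : c.par^[n] x ≠ c.root := by
  intro e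
  have := c.depth_iterate_par n x hn.le
  rw [e, c.depth_root] at this
  omega

lemma iterate_par_depth (x : I) : c.par^[c.depth x] x = c.root :=
  c.depth_eq_zero _ (by rw [c.depth_iterate_par _ x le_rfl, Nat.sub_self])

lemma mem_branch_self (x : I) : x ∈ c.branch x := ⟨0, rfl⟩

lemma mem_branch_of_par_mem {x y : I} (h : c.par y ∈ c.branch x) : y ∈ c.branch x := by
  obtain ⟨n, hn⟩ := h
  exact ⟨n + 1, hn⟩

lemma root_notMem_branch {b : I} (hb : b ≠ c.root) : c.root ∉ c.branch b := by
  rintro ⟨n, hn⟩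
  rw [Function.iterate_fixed c.par_root] at hn
  exact hb hn.symm

lemma isCut_branch {b : I} (hb : b ≠ c.root) : c.IsCut (c.branch b) b (c.par b) where
  mem := c.mem_branch_self b
  notMem := by
    rintro ⟨n, hn⟩
    have h1 := c.depth_iterate_par_le n (c.par b)
    have h2 := c.depth_par b hb
    rw [hn] at h1
    omega
  eq_of_ne_zero := by
    rintro x ⟨n, hn⟩ y hy hP
    rcases c.P_support x y hP with rfl | rfl | rfl
    · exact absurd ⟨n, hn⟩ hy
    · cases n with
      | zero => exact ⟨hn, congrArg c.par hn⟩
      | succ n => exact absurd ⟨n, hn⟩ hy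
    · exact absurd (c.mem_branch_of_par_mem ⟨n, hn⟩) hy

/-- The resistance `1 / (μ_b π(b))` of the edge from `b` to its parent. -/
def resistance (b : I) : ℝ≥0∞ := (c.mu b * c.invm b)⁻¹

lemma resistance_ne_top {b : I} (hb : b ≠ c.root) : c.resistance b ≠ ∞ :=
  ENNReal.inv_ne_top.2 (mul_ne_zero (c.mu_pos b hb) (c.invm_pos b))

lemma resistance_mul_conductance {b : I} (hb : b ≠ c.root) :
    c.resistance b * (c.invm b * c.P b (c.par b)) = 1 := by
  rw [resistance, mu, mul_comm (c.invm b)]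
  exact ENNReal.inv_mul_cancel (mul_ne_zero (c.mu_pos b hb) (c.invm_pos b))
    (ENNReal.mul_ne_top (c.P_ne_top _ _) (c.invm_ne_top b))

lemma tsum_survival_root_le_add {b : I} (hb : b ≠ c.root) :
    ∑' t, c.survival c.root t b ≤
      c.piSet (c.branch b) * c.resistance b + ∑' t, c.survival c.root t (c.par b) := by
  have h := (c.isCut_branch hb).tsum_survival_le (c.root_notMem_branch hb)
  have h' := mul_le_mul_right h (c.resistance b)
  simpa only [mul_add, ← mul_assoc, mul_assoc (c.resistance b) (c.invm b),
    c.resistance_mul_conductance hb, one_mul,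
    mul_comm (c.resistance b) (c.piSet _)] using h'

lemma tsum_survival_par_eq [Countable I] [MeasurableSingletonClass I] {a b : I} (hb : b ≠ c.root)
    (ha : a ∈ c.branch b) (hfin : ∀ x ∉ c.branch b, ∑' t, c.survival a t x ≠ ∞) :
    ∑' t, c.survival a t (c.par b) =
      c.piSet (c.branch b)ᶜ * c.resistance b + ∑' t, c.survival a t b := by
  have h := (c.isCut_branch hb).compl.tsum_survival_eq (not_not.2 ha) hfin
  rw [c.invm_rev] at h
  have h' := congrArg (c.resistance b * ·) h
  simpa only [mul_add, ← mul_assoc, mul_assoc (c.resistance b) (c.invm b),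
    c.resistance_mul_conductance hb, one_mul,
    mul_comm (c.resistance b) (c.piSet _)] using h'

lemma tsum_survival_eq_one_add {x z : I} (hx : x ≠ z) :
    ∑' t, c.survival z t x = 1 + ∑' y, c.P x y * ∑' t, c.survival z t y := by
  rw [tsum_eq_zero_add' ENNReal.summable]
  congr 1
  · simp [survival, hx]
  · simp only [c.survival_succ hx, ← ENNReal.tsum_mul_left]
    exact ENNReal.tsum_comm

/-- If the root reaches `a` in finite mean time, so does every vertex off a branch containing `a`. -/
lemma tsum_survival_ne_top {a b : I} (ha : a ∈ c.branch b)
    (hroot : ∑' t, c.survival a t c.root ≠ ∞) {x : I} (hx : x ∉ c.branch b) :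
    ∑' t, c.survival a t x ≠ ∞ := by
  induction hn : c.depth x generalizing x with
  | zero => rwa [c.depth_eq_zero x hn]
  | succ n ih =>
    have hxr : x ≠ c.root := fun e => by
      rw [e, c.depth_root] at hn
      omega
    have hpar : c.par x ∉ c.branch b := fun hmem => hx (c.mem_branch_of_par_mem hmem)
    have hdepth : c.depth (c.par x) = n := by
      have := c.depth_par x hxr
      omega
    have hne : c.par x ≠ a := fun e => hpar (e ▸ ha)
    have hfin := ih hpar hdepth
    rw [c.tsum_survival_eq_one_add hne] at hfin
    have hle : c.P (c.par x) x * ∑' t, c.survival a t x ≠ ∞ :=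
      ne_top_of_le_ne_top hfin
        ((ENNReal.le_tsum (f := fun y => c.P (c.par x) y * ∑' t, c.survival a t y) x).trans
          le_add_self)
    intro htop
    rw [htop, ENNReal.mul_top (c.lam_pos x hxr)] at hle
    exact hle rfl

lemma ET_root_le [Countable I] [MeasurableSingletonClass I] (a : I) :
    c.ET a c.root ≤ ∑ i ∈ Finset.range (c.depth a),
      c.piSet (c.branch (c.par^[i] a)) * c.resistance (c.par^[i] a) := by
  have h : ∀ n ≤ c.depth a, ∑' t, c.survival c.root t a ≤
      (∑ i ∈ Finset.range n, c.piSet (c.branch (c.par^[i] a)) * c.resistance (c.par^[i] a)) +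
        ∑' t, c.survival c.root t (c.par^[n] a) := by
    intro n hn
    induction n with
    | zero => simp
    | succ n ih =>
      refine (ih (by omega)).trans ?_
      rw [Finset.sum_range_succ, add_assoc, Function.iterate_succ_apply']
      gcongr
      exact c.tsum_survival_root_le_add (c.iterate_par_ne_root hn)
  have h' := h _ le_rfl
  rw [c.iterate_par_depth] at h'
  simpa [ET_eq_tsum_survival, survival_self] using h'

lemma ET_from_root_eq [Countable I] [MeasurableSingletonClass I] (a : I)
    (hfin : c.ET c.root a ≠ ∞) :
    c.ET c.root a = ∑ i ∈ Finset.range (c.depth a),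
      c.piSet (c.branch (c.par^[i] a))ᶜ * c.resistance (c.par^[i] a) := by
  rw [ET_eq_tsum_survival] at hfin ⊢
  have h : ∀ n ≤ c.depth a, ∑' t, c.survival a t (c.par^[n] a) =
      ∑ i ∈ Finset.range n,
        c.piSet (c.branch (c.par^[i] a))ᶜ * c.resistance (c.par^[i] a) := by
    intro n hn
    induction n with
    | zero => simp [survival_self]
    | succ n ih =>
      have ha : a ∈ c.branch (c.par^[n] a) := ⟨n, rfl⟩
      rw [Finset.sum_range_succ, Function.iterate_succ_apply', c.tsum_survival_par_eq
        (c.iterate_par_ne_root hn) ha fun x hx => c.tsum_survival_ne_top ha hfin hx,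
        ih (by omega), add_comm]
  have h' := h _ le_rfl
  rwa [c.iterate_par_depth] at h'

lemma sum_le_Rsum (a : I) :
    ∑ i ∈ Finset.range (c.depth a),
      c.piSet (c.branch (c.par^[i] a)) ^ 2 * c.resistance (c.par^[i] a) ≤ c.Rsum a := by
  let g : Fin (c.depth a) → c.pathToRoot a := fun i => ⟨c.par^[i] a, i, i.2, rfl⟩
  have hg : Function.Injective g := by
    intro i j hij
    have hd := congrArg (fun b : c.pathToRoot a => c.depth b) hij
    simp only [g, c.depth_iterate_par _ a i.2.le, c.depth_iterate_par _ a j.2.le] at hd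
    have hi := i.2
    have hj := j.2
    ext
    omega
  have h := ENNReal.tsum_comp_le_tsum_of_injective hg fun b : c.pathToRoot a =>
    (c.piSet (c.branch (b : I))) ^ 2 / (c.mu (b : I) * c.invm (b : I))
  rw [tsum_fintype] at h
  rw [← Fin.sum_univ_eq_sum_range
    (fun i => c.piSet (c.branch (c.par^[i] a)) ^ 2 * c.resistance (c.par^[i] a))]
  exact h

lemma piSet_ne_top (S : Set I) : c.piSet S ≠ ∞ :=
  ne_top_of_le_ne_top one_ne_top (c.piSet_add_piSet_compl S ▸ le_self_add)

lemma ET_root_ne_top [Countable I] [MeasurableSingletonClass I] (a : I) : c.ET a c.root ≠ ∞ :=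
  ne_top_of_le_ne_top (ENNReal.sum_ne_top.2 fun _ hi => ENNReal.mul_ne_top (c.piSet_ne_top _)
    (c.resistance_ne_top (c.iterate_par_ne_root (Finset.mem_range.1 hi)))) (c.ET_root_le a)

/-- Cauchy–Schwarz with weights: `(∑ p w)² ≤ (∑ p² w) (∑ w)`. -/
lemma sum_mul_sq_le {ι : Type*} (s : Finset ι) (p w : ι → ℝ≥0∞) (hp : ∀ i ∈ s, p i ≠ ∞)
    (hw : ∀ i ∈ s, w i ≠ ∞) :
    (∑ i ∈ s, p i * w i) ^ 2 ≤ (∑ i ∈ s, p i ^ 2 * w i) * ∑ i ∈ s, w i := by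
  have hcs := Finset.sum_sq_le_sum_mul_sum_of_sq_le_mul s
    (r := fun i => (p i).toNNReal * (w i).toNNReal)
    (f := fun i => (p i).toNNReal ^ 2 * (w i).toNNReal) (g := fun i => (w i).toNNReal)
    (fun _ _ => zero_le) (fun _ _ => zero_le) fun i _ => by
      rw [mul_pow, sq (w i).toNNReal, mul_assoc]
  have hcoe := ENNReal.coe_le_coe.2 hcs
  simp only [ENNReal.coe_pow, ENNReal.coe_mul, ENNReal.ofNNReal_finsetSum] at hcoe
  have hp' : ∀ i ∈ s, ((p i).toNNReal : ℝ≥0∞) = p i := fun i hi => ENNReal.coe_toNNReal (hp i hi)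
  have hw' : ∀ i ∈ s, ((w i).toNNReal : ℝ≥0∞) = w i := fun i hi => ENNReal.coe_toNNReal (hw i hi)
  convert hcoe using 2
  · exact Finset.sum_congr rfl fun i hi => by rw [hp' i hi, hw' i hi]
  · exact Finset.sum_congr rfl fun i hi => by rw [hp' i hi, hw' i hi]
  · exact Finset.sum_congr rfl fun i hi => (hw' i hi).symm

/-- Since `t ↦ t² / (t + e)` is increasing, the bound `k² ≤ r (k + e)` passes to every `h ≤ k`. -/
lemma sq_le_mul_add_of_le {h k e r : ℝ≥0∞} (hk : h ≤ k) (hktop : k ≠ ∞) (he : e ≠ ∞)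
    (hsq : k ^ 2 ≤ r * (k + e)) : h ^ 2 ≤ r * (h + e) := by
  by_cases hr : r = ∞
  · subst hr
    rcases eq_or_ne h 0 with rfl | h0
    · simp
    · rw [ENNReal.top_mul (by simp [h0])]
      exact le_top
  have hhtop : h ≠ ∞ := ne_top_of_le_ne_top hktop hk
  lift h to NNReal using hhtop
  lift k to NNReal using hktop
  lift e to NNReal using he
  lift r to NNReal using hr
  norm_cast at hk hsq ⊢
  rcases eq_or_ne h 0 with rfl | h0
  · simp
  · refine le_of_mul_le_mul_right ?_ (show 0 < k + e from
      add_pos_of_pos_of_nonneg ((pos_iff_ne_zero.2 h0).trans_le hk) zero_le)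
    calc h ^ 2 * (k + e) = h * k * h + h ^ 2 * e := by ring
      _ ≤ h * k * k + k ^ 2 * e := by gcongr
      _ = k ^ 2 * (h + e) := by ring
      _ ≤ (r * (k + e)) * (h + e) := by gcongr
      _ = r * (h + e) * (k + e) := by ring

lemma ET_sq_le [Countable I] [MeasurableSingletonClass I] (a : I) (hfin : c.ET c.root a ≠ ∞) :
    c.ET a c.root ^ 2 ≤ c.Rsum a * (c.ET a c.root + c.ET c.root a) := by
  have hres : ∀ i ∈ Finset.range (c.depth a), c.resistance (c.par^[i] a) ≠ ∞ := fun i hi =>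
    c.resistance_ne_top (c.iterate_par_ne_root (Finset.mem_range.1 hi))
  refine sq_le_mul_add_of_le (c.ET_root_le a) (ENNReal.sum_ne_top.2 fun i hi =>
    ENNReal.mul_ne_top (c.piSet_ne_top _) (hres i hi)) hfin ?_
  rw [c.ET_from_root_eq a hfin, ← Finset.sum_add_distrib]
  simp only [← add_mul, c.piSet_add_piSet_compl, one_mul]
  refine (sum_mul_sq_le _ _ _ (fun i _ => c.piSet_ne_top _) hres).trans ?_
  gcongr
  exact c.sum_le_Rsum a

lemma ET_div_add_le [Countable I] [MeasurableSingletonClass I] (a : I) :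
    c.ET a c.root / (c.ET a c.root + c.ET c.root a) ≤ c.Rsum a / c.ET a c.root := by
  rcases eq_or_ne (c.ET a c.root) 0 with h0 | h0
  · simp [h0]
  by_cases hfin : c.ET c.root a = ∞
  · simp [hfin]
  have htop := c.ET_root_ne_top a
  rw [ENNReal.le_div_iff_mul_le (Or.inl h0) (Or.inl htop), mul_comm, ← mul_div_assoc, ← sq]
  exact ENNReal.div_le_of_le_mul (c.ET_sq_le a hfin)

end TreeChain

/-- If `h / (h + e)` is at most `r ≤ 1 / 2` then `h / e` is at most `2 r`. -/
lemma ENNReal.div_le_two_mul_of_div_add_le {h e r : ℝ≥0∞} (hh : h ≠ ∞)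
    (hle : h / (h + e) ≤ r) (hr : r ≤ 2⁻¹) : h / e ≤ 2 * r := by
  rcases eq_or_ne h 0 with rfl | h0
  · simp
  by_cases he : e = ∞
  · simp [he]
  have hmul : h ≤ r * (h + e) :=
    (ENNReal.div_le_iff (by simp [h0]) (ENNReal.add_ne_top.2 ⟨hh, he⟩)).1 hle
  refine ENNReal.div_le_of_le_mul ?_
  have hhalf : 2⁻¹ * h + 2⁻¹ * h ≤ 2⁻¹ * h + r * e := by
    rw [← add_mul, ENNReal.inv_two_add_inv_two, one_mul]
    calc h ≤ r * h + r * e := by rwa [← mul_add]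
      _ ≤ _ := by gcongr
  have hcancel := ENNReal.le_of_add_le_add_left
    (ENNReal.mul_ne_top (ENNReal.inv_ne_top.2 two_ne_zero) hh) hhalf
  rwa [mul_assoc, ← ENNReal.inv_mul_le_iff two_ne_zero ofNat_ne_top]

/-- **Lemma 4.4**: if `R_a/E[T^a_0] → 0` then `E[T^a_0]/E[T^0_a] → 0`;
in fact `E[T^a_0]/(E[T^a_0] + E[T^0_a]) ≤ R_a/E[T^a_0]`. -/
theorem escape_timescale_of_Rsum {I : ℕ → Type*} [∀ n, MeasurableSpace (I n)]
    [∀ n, Countable (I n)] (c : ∀ n, TreeChain (I n)) (a : ∀ n, I n)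
    (hdepth : Tendsto (fun n => (c n).depth (a n)) atTop atTop)
    (hR : Tendsto (fun n => (c n).Rsum (a n) / (c n).ET (a n) (c n).root)
      atTop (𝓝 0)) :
    Tendsto (fun n => (c n).ET (a n) (c n).root / (c n).ET (c n).root (a n))
      atTop (𝓝 0) ∧
    ∀ n, (c n).ET (a n) (c n).root /
          ((c n).ET (a n) (c n).root + (c n).ET (c n).root (a n))
        ≤ (c n).Rsum (a n) / (c n).ET (a n) (c n).root := by
  have hsingle : ∀ n, MeasurableSingletonClass (I n) := fun n => (c n).measurableSingletonClass
  have hle := fun n => (c n).ET_div_add_le (a n)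
  refine ⟨?_, hle⟩
  have hR2 : Tendsto (fun n => 2 * ((c n).Rsum (a n) / (c n).ET (a n) (c n).root)) atTop (𝓝 0) := by
    simpa using ENNReal.Tendsto.const_mul hR (Or.inr ofNat_ne_top)
  refine tendsto_of_tendsto_of_tendsto_of_le_of_le' tendsto_const_nhds hR2
    (Eventually.of_forall fun n => zero_le) ?_
  filter_upwards [hR.eventually_le_const (ENNReal.inv_pos.2 (ofNat_ne_top (n := 2)))] with n hn
  exact ENNReal.div_le_two_mul_of_div_add_le ((c n).ET_root_ne_top (a n)) (hle n) hn
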